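/- arXiv:1410.4508 — 12 statements merged into one kernel-verified Lean document; each statement's English description precedes it below -/
import Mathlib

section
/- Let n ≥ 1 and let ℓ : Fin (n+1) → ℕ be a weight vector with all components positive. Then for every index i one has ((ℓ^♯)^♯) i = (∏_{j} ℓ j)^(n-1) * ℓ i, i.e. the double sharp of ℓ equals ℓ multiplied componentwise by m := (ℓ 0 · ℓ 1 ⋯ ℓ n)^(n-1). -/
/-- The sharp of a weight vector: `(ℓ^♯) i = ∏_{j ≠ i} ℓ j`. -/
def sharp {n : ℕ} (ℓ : Fin (n + 1) → ℕ) : Fin (n + 1) → ℕ :=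
  fun i => ∏ j ∈ Finset.univ.erase i, ℓ j

/-- The double sharp of a positive weight vector `ℓ` equals `ℓ` multiplied
componentwise by `m := (∏ j, ℓ j)^(n-1)`. -/
theorem double_sharp (n : ℕ) (hn : 1 ≤ n) (ℓ : Fin (n + 1) → ℕ)
    (hpos : ∀ i, 0 < ℓ i) (i : Fin (n + 1)) :
    sharp (sharp ℓ) i = (∏ j, ℓ j) ^ (n - 1) * ℓ i := by
  have hQ : 0 < ∏ j ∈ Finset.univ.erase i, ℓ j := Finset.prod_pos fun j _ => hpos j
  apply Nat.eq_of_mul_eq_mul_right hQ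
  have key : ∀ j, sharp ℓ j * ℓ j = ∏ k, ℓ k := fun j =>
    Finset.prod_erase_mul _ _ (Finset.mem_univ j)
  have h1 : sharp (sharp ℓ) i * ∏ j ∈ Finset.univ.erase i, ℓ j = (∏ k, ℓ k) ^ n := by
    show (∏ j ∈ Finset.univ.erase i, sharp ℓ j) * _ = _
    rw [← Finset.prod_mul_distrib, Finset.prod_congr rfl fun j _ => key j,
      Finset.prod_const, Finset.card_erase_of_mem (Finset.mem_univ i)]
    simp
  rw [h1, mul_assoc, Finset.mul_prod_erase _ _ (Finset.mem_univ i), ← pow_succ,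
    Nat.sub_add_cancel hn]
end

section
/- Let n ≥ 0 and let m : Fin (n+1) → ℕ have all components positive. Then the weight vector ℓ := m^♯ is coprime (the gcd of all components of m^♯ equals 1) if and only if m is pairwise coprime. -/
/-- The weight vector `m^♯` is coprime if and only if `m` is pairwise coprime. -/
theorem sharp_coprime_iff_pairwise_coprime (n : ℕ) (m : Fin (n + 1) → ℕ)
    (hpos : ∀ i, 0 < m i) :
    Finset.univ.gcd (sharp m) = 1 ↔ ∀ i j, i ≠ j → Nat.gcd (m i) (m j) = 1 := by
  constructor
  · intro h i j hij
    have hd : Nat.gcd (m i) (m j) ∣ Finset.univ.gcd (sharp m) := by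
      refine Finset.dvd_gcd fun k _ => ?_
      by_cases hk : i = k
      · exact (Nat.gcd_dvd_right _ _).trans
          (Finset.dvd_prod_of_mem m (Finset.mem_erase.2 ⟨fun e => hij (hk.trans e.symm), Finset.mem_univ j⟩))
      · exact (Nat.gcd_dvd_left _ _).trans
          (Finset.dvd_prod_of_mem m (Finset.mem_erase.2 ⟨hk, Finset.mem_univ i⟩))
    rw [h] at hd
    exact Nat.dvd_one.1 hd
  · intro h
    by_contra hne
    obtain ⟨p, hp, hpd⟩ := Nat.exists_prime_and_dvd hne
    have key : ∀ k, ∃ j, j ≠ k ∧ p ∣ m j := by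
      intro k
      have h1 : p ∣ ∏ j ∈ Finset.univ.erase k, m j :=
        hpd.trans (Finset.gcd_dvd (f := sharp m) (Finset.mem_univ k))
      obtain ⟨j, hj, hpj⟩ := (Prime.dvd_finset_prod_iff hp.prime m).1 h1
      exact ⟨j, (Finset.mem_erase.1 hj).1, hpj⟩
    obtain ⟨j, _, hj⟩ := key 0
    obtain ⟨k, hkj, hk⟩ := key j
    have h2 := Nat.dvd_gcd hk hj
    rw [h k j hkj] at h2
    exact hp.one_lt.ne' (Nat.dvd_one.1 h2)
end

section
/- Let n ≥ 0 and let ℓ : Fin (n+1) → ℕ be a coprime weight vector with all components positive. Define a step relation on positive weight vectors: ℓ ⟶ ℓ' holds if there exist a prime p and an index k such that either (admissible multiplication) p does not divide ℓ k, ℓ' k = ℓ k and ℓ' i = p * ℓ i for all i ≠ k, or (admissible division) p divides ℓ i for every i ≠ k, p does not divide ℓ k, ℓ' k = ℓ k and ℓ' i = ℓ i / p for all i ≠ k. Then ℓ can be transformed into the constant vector (1,…,1) by finitely many such steps (Relation.ReflTransGen of the step relation relates ℓ to fun _ => 1) if and only if there exists a pairwise coprime, componentwise positive vector p : Fin (n+1)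 → ℕ with ℓ = p^♯. -/
/-- One step: an admissible multiplication or an admissible division by a prime `p`
at an index `k`. -/
def Step (n : ℕ) (ℓ ℓ' : Fin (n + 1) → ℕ) : Prop :=
  ∃ (p : ℕ) (k : Fin (n + 1)), p.Prime ∧
    ((¬ p ∣ ℓ k ∧ ℓ' k = ℓ k ∧ ∀ i, i ≠ k → ℓ' i = p * ℓ i) ∨
     ((∀ i, i ≠ k → p ∣ ℓ i) ∧ ¬ p ∣ ℓ k ∧ ℓ' k = ℓ k ∧ ∀ i, i ≠ k → ℓ' i = ℓ i / p))

lemma sharp_update_self {n : ℕ} (q : Fin (n + 1) → ℕ) (k : Fin (n + 1)) (c : ℕ) :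
    sharp (Function.update q k c) k = sharp q k := by
  unfold sharp
  refine Finset.prod_congr rfl fun j hj => ?_
  rw [Function.update_of_ne (Finset.ne_of_mem_erase hj)]

lemma sharp_update_mul {n : ℕ} (q : Fin (n + 1) → ℕ) (k i : Fin (n + 1)) (hi : i ≠ k)
    (p c : ℕ) :
    sharp (Function.update q k (p * c)) i = p * sharp (Function.update q k c) i := by
  unfold sharp
  have hk : k ∈ Finset.univ.erase i := by simp [hi.symm]
  rw [← Finset.mul_prod_erase _ _ hk, ← Finset.mul_prod_erase _ _ hk]
  simp only [Function.update_self]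
  rw [mul_assoc]
  congr 2
  refine Finset.prod_congr rfl fun j hj => ?_
  rw [Function.update_of_ne (Finset.ne_of_mem_erase hj),
    Function.update_of_ne (Finset.ne_of_mem_erase hj)]

lemma pairwise_update {n : ℕ} (q : Fin (n + 1) → ℕ) (k : Fin (n + 1)) (c : ℕ)
    (hq : ∀ i j, i ≠ j → Nat.gcd (q i) (q j) = 1)
    (hc : ∀ j, j ≠ k → Nat.gcd c (q j) = 1) :
    ∀ i j, i ≠ j →
      Nat.gcd (Function.update q k c i) (Function.update q k c j) = 1 := by
  intro i j hij
  by_cases hi : i = k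
  · subst hi
    rw [Function.update_self, Function.update_of_ne hij.symm]
    exact hc j hij.symm
  · rw [Function.update_of_ne hi]
    by_cases hj : j = k
    · subst hj
      rw [Function.update_self, Nat.gcd_comm]
      exact hc i hi
    · rw [Function.update_of_ne hj]
      exact hq i j hij

lemma pos_update {n : ℕ} (q : Fin (n + 1) → ℕ) (k : Fin (n + 1)) (c : ℕ)
    (hq : ∀ i, 0 < q i) (hc : 0 < c) : ∀ i, 0 < Function.update q k c i := by
  intro i
  by_cases hi : i = k
  · subst hi; simpa using hc
  · rw [Function.update_of_ne hi]; exact hq i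

lemma sharp_of_step {n : ℕ} (a b : Fin (n + 1) → ℕ) (h : Step n a b)
    (hb : ∃ p : Fin (n + 1) → ℕ, (∀ i, 0 < p i) ∧
        (∀ i j, i ≠ j → Nat.gcd (p i) (p j) = 1) ∧ b = sharp p) :
    ∃ p : Fin (n + 1) → ℕ, (∀ i, 0 < p i) ∧
        (∀ i j, i ≠ j → Nat.gcd (p i) (p j) = 1) ∧ a = sharp p := by
  obtain ⟨q, hpos, hq, rfl⟩ := hb
  obtain ⟨p, k, hp, ⟨hk, hkk, hi⟩ | ⟨hd, hk, hkk, hi⟩⟩ := h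
  · by_cases hne : ∃ i, i ≠ k
    · obtain ⟨i, hik⟩ := hne
      have h1 : p ∣ sharp q i := by rw [hi i hik]; exact dvd_mul_right _ _
      obtain ⟨j, hj, hpj⟩ := (hp.prime.dvd_finsetProd_iff _).1 h1
      have hjk : j = k := by
        by_contra hjk
        apply hk
        rw [← hkk]
        exact hpj.trans (Finset.dvd_prod_of_mem _ (by simp [hjk]))
      subst hjk
      obtain ⟨r, hr⟩ := hpj
      have hrp : 0 < r := by
        have := hpos j
        rw [hr] at this
        exact Nat.pos_of_mul_pos_left this
      refine ⟨Function.update q j r, pos_update q j r hpos hrp,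
        pairwise_update q j r hq ?_, ?_⟩
      · intro i hi
        exact Nat.Coprime.coprime_dvd_left ⟨p, by rw [hr, mul_comm]⟩ (hq j i hi.symm)
      · funext i
        by_cases hij : i = j
        · subst hij; rw [sharp_update_self, hkk]
        · have h2 := sharp_update_mul q j i hij p r
          rw [← hr, Function.update_eq_self, hi i hij] at h2
          exact Nat.eq_of_mul_eq_mul_left hp.pos h2
    · push Not at hne
      refine ⟨q, hpos, hq, ?_⟩
      funext i
      rw [hne i, hkk]
  · refine ⟨Function.update q k (p * q k),
      pos_update q k _ hpos (Nat.mul_pos hp.pos (hpos k)), pairwise_update q k _ hq ?_, ?_⟩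
    · intro j hj
      refine Nat.Coprime.mul_left ?_ (hq k j hj.symm)
      rw [hp.coprime_iff_not_dvd]
      intro hpj
      apply hk
      rw [← hkk]
      exact hpj.trans (Finset.dvd_prod_of_mem _ (by simp [hj]))
    · funext i
      by_cases hik : i = k
      · subst hik; rw [sharp_update_self, hkk]
      · rw [sharp_update_mul q k i hik, Function.update_eq_self, hi i hik,
          Nat.mul_div_cancel' (hd i hik)]

lemma reach_of_sharp {n : ℕ} : ∀ (N : ℕ) (q : Fin (n + 1) → ℕ), ∑ i, q i = N →
    (∀ i, 0 < q i) → (∀ i j, i ≠ j → Nat.gcd (q i) (q j) = 1) →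
    Relation.ReflTransGen (Step n) (sharp q) (fun _ => 1) := by
  intro N
  induction N using Nat.strong_induction_on with
  | _ N ih =>
    intro q hN hpos hq
    by_cases h1 : ∀ i, q i = 1
    · have : sharp q = fun _ => 1 := by
        funext i
        simp [sharp, h1]
      rw [this]
    · push Not at h1
      obtain ⟨k, hk⟩ := h1
      obtain ⟨p, hp, r, hr⟩ := Nat.exists_prime_and_dvd hk
      have hrp : 0 < r := by
        have := hpos k
        rw [hr] at this
        exact Nat.pos_of_mul_pos_left this
      have hlt : r < q k := by
        rw [hr]; nlinarith [hp.two_le]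
      have hsum : ∑ i, Function.update q k r i < N := by
        rw [← hN]
        refine Finset.sum_lt_sum (fun i _ => ?_) ⟨k, Finset.mem_univ _, by simpa using hlt⟩
        by_cases hi : i = k
        · subst hi; simpa using hlt.le
        · rw [Function.update_of_ne hi]
      have hmul : ∀ i, i ≠ k → sharp q i = p * sharp (Function.update q k r) i := by
        intro i hi
        have h2 := sharp_update_mul q k i hi p r
        rwa [← hr, Function.update_eq_self] at h2
      refine Relation.ReflTransGen.head ?_ (ih _ hsum _ rfl (pos_update q k r hpos hrp)
        (pairwise_update q k r hq ?_))
      · refine ⟨p, k, hp, Or.inr ⟨fun i hi => ?_, ?_, sharp_update_self q k r, fun i hi => ?_⟩⟩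
        · rw [hmul i hi]; exact dvd_mul_right _ _
        · intro hd
          obtain ⟨j, hj, hpj⟩ := (hp.prime.dvd_finsetProd_iff _).1 hd
          have h3 := Nat.dvd_gcd hpj (Dvd.intro _ hr.symm : p ∣ q k)
          rw [hq j k (Finset.ne_of_mem_erase hj)] at h3
          exact hp.one_lt.ne' (Nat.dvd_one.1 h3)
        · rw [hmul i hi, Nat.mul_div_cancel_left _ hp.pos]
      · intro i hi
        exact Nat.Coprime.coprime_dvd_left ⟨p, by rw [hr, mul_comm]⟩ (hq k i hi.symm)


/-- A coprime positive weight vector can be transformed into `(1,…,1)` by finitely many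
admissible multiplications and divisions if and only if it is the sharp of a pairwise
coprime positive vector. -/
theorem reachable_one_iff_sharp_of_pairwise_coprime (n : ℕ) (ℓ : Fin (n + 1) → ℕ)
    (hpos : ∀ i, 0 < ℓ i) (hcop : Finset.univ.gcd ℓ = 1) :
    Relation.ReflTransGen (Step n) ℓ (fun _ => 1) ↔
      ∃ p : Fin (n + 1) → ℕ, (∀ i, 0 < p i) ∧
        (∀ i j, i ≠ j → Nat.gcd (p i) (p j) = 1) ∧ ℓ = sharp p := by
  constructor
  · intro h
    clear hpos hcop
    induction h using Relation.ReflTransGen.head_induction_on with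
    | refl => exact ⟨fun _ => 1, by simp, by simp, by funext i; simp [sharp]⟩
    | head h1 _ ih => exact sharp_of_step _ _ h1 ih
  · rintro ⟨q, h1, h2, rfl⟩
    exact reach_of_sharp _ q rfl h1 h2
end

section
/- Let n ≥ 0 and let ℓ : Fin (n+1) → ℕ be a coprime weight vector with all components positive. Then there exists a pairwise coprime, componentwise positive vector p : Fin (n+1) → ℕ with ℓ = p^♯ if and only if for all indices i, j, k with i ≠ j and j ≠ k, the natural number ℓ i / Nat.gcd (ℓ i) (ℓ j) divides ℓ k. -/
/-- A coprime positive weight vector `ℓ` is the sharp of a pairwise coprime positive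
vector if and only if `ℓ i / gcd(ℓ i, ℓ j)` divides `ℓ k` whenever `i ≠ j` and `j ≠ k`. -/
theorem sharp_iff_quotient_divides (n : ℕ) (ℓ : Fin (n + 1) → ℕ)
    (hpos : ∀ i, 0 < ℓ i) (hcop : Finset.univ.gcd ℓ = 1) :
    (∃ p : Fin (n + 1) → ℕ, (∀ i, 0 < p i) ∧
        (∀ i j, i ≠ j → Nat.gcd (p i) (p j) = 1) ∧ ℓ = sharp p) ↔
      ∀ i j k : Fin (n + 1), i ≠ j → j ≠ k →
        (ℓ i / Nat.gcd (ℓ i) (ℓ j)) ∣ ℓ k := by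
  constructor
  · rintro ⟨p, hp, hc, rfl⟩ i j k hij hjk
    have h1 : sharp p i = p j * ∏ m ∈ (Finset.univ.erase i).erase j, p m :=
      (Finset.mul_prod_erase _ p (by simp [hij.symm])).symm
    have h2 : sharp p j = p i * ∏ m ∈ (Finset.univ.erase i).erase j, p m := by
      rw [Finset.erase_right_comm]
      exact (Finset.mul_prod_erase _ p (by simp [hij])).symm
    have hP : 0 < ∏ m ∈ (Finset.univ.erase i).erase j, p m :=
      Finset.prod_pos fun m _ => hp m
    rw [h1, h2, Nat.gcd_mul_right, hc j i hij.symm, one_mul, Nat.mul_div_cancel _ hP]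
    exact Finset.dvd_prod_of_mem p (by simp [hjk])
  · intro h
    rcases Nat.eq_zero_or_pos n with rfl | hn
    · refine ⟨fun _ => 1, fun _ => one_pos, fun _ _ _ => by simp, ?_⟩
      funext i
      have : i = 0 := Fin.fin_one_eq_zero i
      subst this
      simpa [sharp] using hcop
    · have hne : ∀ j : Fin (n + 1), ∃ i, i ≠ j := by
        intro j
        have : Nontrivial (Fin (n + 1)) := Fin.nontrivial_iff_two_le.2 (by omega)
        exact exists_ne j
      have hd : ∀ i j, i ≠ j → (Finset.univ.erase j).gcd ℓ ∣ ℓ i := fun i j hij =>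
        Finset.gcd_dvd (by simp [hij])
      have hc : ∀ i j : Fin (n + 1), i ≠ j →
          Nat.gcd ((Finset.univ.erase i).gcd ℓ) ((Finset.univ.erase j).gcd ℓ) = 1 := by
        intro i j hij
        apply Nat.dvd_one.1
        refine dvd_trans ?_ hcop.dvd
        refine Finset.dvd_gcd fun m _ => ?_
        by_cases hm : m = i
        · exact (Nat.gcd_dvd_right _ _).trans (hd m j (hm ▸ hij))
        · exact (Nat.gcd_dvd_left _ _).trans (hd m i hm)
      refine ⟨fun j => (Finset.univ.erase j).gcd ℓ, ?_, hc, ?_⟩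
      · intro j
        obtain ⟨i, hi⟩ := hne j
        exact Nat.pos_of_dvd_of_pos (hd i j hi) (hpos i)
      · funext i
        apply Nat.dvd_antisymm
        · rw [Nat.dvd_iff_prime_pow_dvd_dvd]
          intro q e hq hqe
          rcases Nat.eq_zero_or_pos e with rfl | he
          · simp
          have hj : ∃ j, ¬ q ∣ ℓ j := by
            by_contra! hall
            apply hq.one_lt.ne'
            apply Nat.dvd_one.1
            rw [← hcop]
            exact Finset.dvd_gcd fun m _ => hall m
          obtain ⟨j, hj⟩ := hj
          have hij : i ≠ j := by
            rintro rfl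
            exact hj ((dvd_pow_self q he.ne').trans hqe)
          have hco : Nat.Coprime (q ^ e) (Nat.gcd (ℓ i) (ℓ j)) :=
            Nat.Coprime.coprime_dvd_right (Nat.gcd_dvd_right _ _)
              (Nat.Coprime.pow_left e ((Nat.Prime.coprime_iff_not_dvd hq).2 hj))
          have hquot : q ^ e ∣ ℓ i / Nat.gcd (ℓ i) (ℓ j) := by
            apply hco.dvd_of_dvd_mul_right
            rwa [Nat.div_mul_cancel (Nat.gcd_dvd_left _ _)]
          have hpj : q ^ e ∣ (Finset.univ.erase j).gcd ℓ :=
            Finset.dvd_gcd fun k hk =>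
              hquot.trans (h i j k hij (Finset.ne_of_mem_erase hk).symm)
          exact hpj.trans (Finset.dvd_prod_of_mem
            (fun j => (Finset.univ.erase j).gcd ℓ) (by simp [hij.symm]))
        · apply Finset.prod_dvd_of_isRelPrime
          · intro a _ b _ hab
            exact Nat.coprime_iff_isRelPrime.1 (hc a b hab)
          · intro j hj
            exact hd i j (Finset.ne_of_mem_erase hj).symm
end

section
/- Let n ≥ 0 and let p : Fin (n+1) → ℕ be pairwise coprime with all components positive. Let k : Fin (n+1) → ℤ. If the product ∏_i p i (viewed in ℤ) divides ∑_i k i * ∏_{j ≠ i} (p j : ℤ), then (p i : ℤ) divides k i for every index i. -/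
/-- If `p` is pairwise coprime and positive and `∏ i, p i` divides
`∑ i, k i * ∏_{j ≠ i} p j`, then `p i` divides `k i` for every `i`. -/
theorem dvd_of_dvd_weighted_sum (n : ℕ) (p : Fin (n + 1) → ℕ)
    (hpos : ∀ i, 0 < p i) (hcop : ∀ i j, i ≠ j → Nat.gcd (p i) (p j) = 1)
    (k : Fin (n + 1) → ℤ)
    (h : (∏ i, (p i : ℤ)) ∣ ∑ i, k i * ∏ j ∈ Finset.univ.erase i, (p j : ℤ)) :
    ∀ i, (p i : ℤ) ∣ k i := by
  intro i
  have h1 : (p i : ℤ) ∣ ∑ i, k i * ∏ j ∈ Finset.univ.erase i, (p j : ℤ) :=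
    (Finset.dvd_prod_of_mem (fun i => (p i : ℤ)) (Finset.mem_univ i)).trans h
  rw [← Finset.add_sum_erase _ _ (Finset.mem_univ i)] at h1
  have h2 : (p i : ℤ) ∣ ∑ l ∈ Finset.univ.erase i,
      k l * ∏ j ∈ Finset.univ.erase l, (p j : ℤ) := by
    refine Finset.dvd_sum fun l hl => Dvd.dvd.mul_left ?_ _
    exact Finset.dvd_prod_of_mem (fun j => (p j : ℤ))
      (Finset.mem_erase.2 ⟨(Finset.ne_of_mem_erase hl).symm, Finset.mem_univ i⟩)
  have h3 := (dvd_add_left h2).1 h1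
  refine IsCoprime.dvd_of_dvd_mul_right ?_ h3
  refine IsCoprime.prod_right fun j hj => ?_
  exact Nat.isCoprime_iff_coprime.2 (hcop i j (Finset.ne_of_mem_erase hj).symm)
end

section
/- With the notation of the context, there exist polynomials a : Fin (n+1) → MvPolynomial (Fin n) ℂ such that ∑_{i : Fin (n+1)} a i * g i = 1 in MvPolynomial (Fin n) ℂ. -/
open MvPolynomial

/-- `x 0 = 1 - ∑ j, X j` and `x (i+1) = X i`. -/
noncomputable def xP (n : ℕ) (i : Fin (n + 1)) : MvPolynomial (Fin n) ℂ :=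
  Fin.cases (1 - ∑ j : Fin n, X j) (fun j => X j) i

/-- `Y i = ∑_{j : Fin n, i ≤ j} X j`. -/
noncomputable def YP (n : ℕ) (i : Fin (n + 1)) : MvPolynomial (Fin n) ℂ :=
  ∑ j ∈ Finset.univ.filter (fun j : Fin n => (i : ℕ) ≤ (j : ℕ)), X j

/-- `g i = ∏_{k=0}^{p i - 1} (x i + C(1 - q^(-2k)) Y i)`, representing `ζ_i ζ_i^*`. -/
noncomputable def gP (n : ℕ) (q : ℝ) (p : Fin (n + 1) → ℕ) (i : Fin (n + 1)) :
    MvPolynomial (Fin n) ℂ :=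
  ∏ k ∈ Finset.range (p i),
    (xP n i + C (1 - (q : ℂ) ^ (-(2 * (k : ℤ)))) * YP n i)

/-- The telescoping relation `Y i = x (i+1) + Y (i+1)`. -/
lemma YP_castSucc (n : ℕ) (i : Fin n) :
    YP n i.castSucc = xP n i.succ + YP n i.succ := by
  have h : Finset.univ.filter (fun j : Fin n => ((i.castSucc : Fin (n+1)) : ℕ) ≤ (j : ℕ))
      = insert i (Finset.univ.filter (fun j : Fin n => ((i.succ : Fin (n+1)) : ℕ) ≤ (j : ℕ))) := by
    ext j
    simp [Fin.ext_iff]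
    omega
  unfold YP
  rw [h, Finset.sum_insert (by simp)]
  simp [xP]

lemma YP_last (n : ℕ) : YP n (Fin.last n) = 0 := by
  unfold YP
  apply Finset.sum_eq_zero
  intro j hj
  have := j.2
  simp at hj
  omega

lemma xP_add_YP_zero (n : ℕ) : xP n 0 + YP n 0 = 1 := by
  simp [xP, YP]

/-- There exist polynomials `a i` with `∑ i, a i * g i = 1`. -/
theorem exists_combination_gP (n : ℕ) (hn : 1 ≤ n) (q : ℝ) (hq0 : 0 < q) (hq1 : q < 1)
    (p : Fin (n + 1) → ℕ) (hp : ∀ i, 1 ≤ p i) :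
    ∃ a : Fin (n + 1) → MvPolynomial (Fin n) ℂ,
      ∑ i : Fin (n + 1), a i * gP n q p i = 1 := by
  rw [← Ideal.mem_span_range_iff_exists_fun, ← Ideal.eq_top_iff_one]
  by_contra hne
  obtain ⟨M, hM, hle⟩ := Ideal.exists_le_maximal _ hne
  have hx : ∀ i, YP n i ∈ M → xP n i ∈ M := by
    intro i hY
    have hg : gP n q p i ∈ M := hle (Ideal.subset_span ⟨i, rfl⟩)
    obtain ⟨k, -, hk⟩ := (hM.isPrime.prod_mem_iff).1 hg
    exact (Ideal.add_mem_iff_left M (M.mul_mem_left _ hY)).1 hk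
  have hY : ∀ i, YP n i ∈ M := by
    intro i
    induction i using Fin.reverseInduction with
    | last => rw [YP_last]; exact M.zero_mem
    | cast i ih => rw [YP_castSucc]; exact M.add_mem (hx _ ih) ih
  exact hM.ne_top ((Ideal.eq_top_iff_one M).2
    (xP_add_YP_zero n ▸ M.add_mem (hx 0 (hY 0)) (hY 0)))
end

section
/- With the notation of the context, the polynomials g 0, g 1, …, g n have no common zero: for every point v : Fin n → ℂ there exists an index i : Fin (n+1) with MvPolynomial.eval v (g i) ≠ 0. -/
open MvPolynomial

theorem YP_castSucc_aux (n : ℕ) (i : Fin n) : YP n i.castSucc = X i + YP n i.succ := by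
  unfold YP
  have h : Finset.univ.filter (fun j : Fin n => ((i.castSucc : Fin (n+1)) : ℕ) ≤ (j : ℕ))
      = insert i (Finset.univ.filter (fun j : Fin n => ((i.succ : Fin (n+1)) : ℕ) ≤ (j : ℕ))) := by
    ext j
    simp only [Finset.mem_filter, Finset.mem_univ, true_and, Finset.mem_insert, Fin.ext_iff,
      Fin.val_castSucc, Fin.val_succ]
    omega
  rw [h, Finset.sum_insert]
  simp

theorem x_zero_aux (n : ℕ) (q : ℝ) (p : Fin (n + 1) → ℕ) (v : Fin n → ℂ) (i : Fin (n + 1))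
    (hg : eval v (gP n q p i) = 0) (hY : eval v (YP n i) = 0) : eval v (xP n i) = 0 := by
  unfold gP at hg
  rw [map_prod, Finset.prod_eq_zero_iff] at hg
  obtain ⟨k, -, hk⟩ := hg
  rw [map_add, map_mul, hY, mul_zero, add_zero] at hk
  exact hk

/-- The polynomials `g 0, …, g n` have no common zero. -/
theorem gP_no_common_zero (n : ℕ) (hn : 1 ≤ n) (q : ℝ) (hq0 : 0 < q) (hq1 : q < 1)
    (p : Fin (n + 1) → ℕ) (hp : ∀ i, 1 ≤ p i) (v : Fin n → ℂ) :
    ∃ i : Fin (n + 1), MvPolynomial.eval v (gP n q p i) ≠ 0 := by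
  by_contra! hcon
  have hY : ∀ i, eval v (YP n i) = 0 := by
    intro i
    induction i using Fin.reverseInduction with
    | last =>
      unfold YP
      rw [Finset.filter_false_of_mem]
      · simp
      · intro j _
        simp
    | cast i ih =>
      have h := x_zero_aux n q p v i.succ (hcon _) ih
      have hx : xP n i.succ = X i := rfl
      rw [YP_castSucc_aux, map_add, ih, ← hx, h, add_zero]
  have h0 := x_zero_aux n q p v 0 (hcon 0) (hY 0)
  have hx : xP n 0 = 1 - YP n 0 := by
    simp [xP, YP]
  rw [hx, map_sub, hY 0] at h0
  simp at h0
end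

section
/- Fix n ≥ 1, an integer k with 1 ≤ k ≤ n, and a real number q with 0 < q < 1. Let W k ⊆ (Fin n → ℕ) be the set of m with m a ≤ m b whenever a ≤ b and (b:ℕ) ≤ k-1, and m b < m a whenever a < b and k-1 ≤ (a:ℕ). Then the function m ↦ q ^ (m ⟨k-1⟩) is summable over W k, i.e. the family (q^{m_k})_{m ∈ W k} has a finite sum. -/
/-- The set `W k` of tuples with `m a ≤ m b` for `a ≤ b`, `(b:ℕ) ≤ k-1`, and
`m b < m a` for `a < b`, `k-1 ≤ (a:ℕ)`. -/
def Wset (n k : ℕ) : Set (Fin n → ℕ) :=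
  {m | (∀ a b : Fin n, a ≤ b → (b : ℕ) ≤ k - 1 → m a ≤ m b) ∧
       (∀ a b : Fin n, a < b → k - 1 ≤ (a : ℕ) → m b < m a)}

/-- The family `(q^{m_k})_{m ∈ W k}` is summable for `0 < q < 1`. -/
theorem summable_qpow_Wset (n k : ℕ) (hn : 1 ≤ n) (hk1 : 1 ≤ k) (hkn : k ≤ n)
    (q : ℝ) (hq0 : 0 < q) (hq1 : q < 1) :
    Summable (fun m : Wset n k => q ^ (m.1 ⟨k - 1, by omega⟩)) := by
  have hF : Summable (fun x : (Σ M : ℕ, (Fin n → Fin (M + 1))) => q ^ x.1) := by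
    rw [summable_sigma_of_nonneg (fun x => by positivity)]
    refine ⟨fun M => Summable.of_finite, ?_⟩
    have h1 : Summable (fun M : ℕ => ((M : ℝ) ^ n * q ^ M)) :=
      summable_pow_mul_geometric_of_norm_lt_one n
        (by rw [Real.norm_of_nonneg hq0.le]; exact hq1)
    have h2 := ((summable_nat_add_iff 1).2 h1).mul_left q⁻¹
    refine h2.congr fun M => ?_
    simp only [tsum_fintype, Finset.sum_const, Finset.card_univ, Fintype.card_pi,
      Fintype.card_fin, Finset.prod_const, nsmul_eq_mul]
    push_cast
    field_simp
    ring
  have hle : ∀ (m : Wset n k) (i : Fin n), m.1 i < m.1 ⟨k - 1, by omega⟩ + 1 := by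
    intro m i
    rcases le_or_gt (i : ℕ) (k - 1) with h | h
    · exact Nat.lt_succ_of_le (m.2.1 i ⟨k - 1, by omega⟩ h le_rfl)
    · exact Nat.lt_succ_of_lt (m.2.2 ⟨k - 1, by omega⟩ i h le_rfl)
  let g : Wset n k → (Σ M : ℕ, (Fin n → Fin (M + 1))) :=
    fun m => ⟨m.1 ⟨k - 1, by omega⟩, fun i => ⟨m.1 i, hle m i⟩⟩
  have hg : Function.Injective g := by
    intro a b hab
    have h3 := congrArg
      (fun x : (Σ M : ℕ, (Fin n → Fin (M + 1))) => fun i => ((x.2 i : ℕ))) hab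
    exact Subtype.ext h3
  exact hF.comp_injective hg
end

section
/- With the notation of the context, for every integer k ≥ 1 one has w * z^k - z^k * w = (1 - q^(2k)) • (z^(k-1) * X) in R. -/
/-- `[w, z^k] = (1 - q^{2k}) • (z^{k-1} X)` in a `ℂ`-algebra with the quantum
sphere relations. -/
theorem comm_w_zpow (R : Type*) [Ring R] [Algebra ℂ R] (q : ℂ) (hq : q ≠ 0)
    (z w X : R)
    (h1 : w * z - z * w = (1 - q ^ 2) • X)
    (h2 : X * z = q ^ 2 • (z * X))
    (h3 : w * X = q ^ 2 • (X * w))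
    (k : ℕ) (hk : 1 ≤ k) :
    w * z ^ k - z ^ k * w = (1 - q ^ (2 * k)) • (z ^ (k - 1) * X) := by
  obtain ⟨n, rfl⟩ : ∃ n, k = n + 1 := ⟨k - 1, by omega⟩
  clear hk
  simp only [Nat.add_sub_cancel]
  induction n with
  | zero => simpa using h1
  | succ n ih =>
    have e : w * z ^ (n + 1 + 1) - z ^ (n + 1 + 1) * w
        = (w * z ^ (n + 1) - z ^ (n + 1) * w) * z + z ^ (n + 1) * (w * z - z * w) := by
      rw [pow_succ z (n + 1)]
      noncomm_ring
    rw [e, ih, h1, smul_mul_assoc, mul_assoc, h2, mul_smul_comm, mul_smul_comm, ← mul_assoc,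
      ← pow_succ, smul_smul, ← add_smul]
    congr 1
    ring
end

section
/- With the notation of the context, for every integer k ≥ 1 one has (z*w) * z^k - z^k * (z*w) = (1 - q^(2k)) • (z^k * X) in R. -/
/-- `[z w, z^k] = (1 - q^{2k}) • (z^k X)` in a `ℂ`-algebra with the quantum
sphere relations. -/
theorem comm_zw_zpow (R : Type*) [Ring R] [Algebra ℂ R] (q : ℂ) (hq : q ≠ 0)
    (z w X : R)
    (h1 : w * z - z * w = (1 - q ^ 2) • X)
    (h2 : X * z = q ^ 2 • (z * X))
    (h3 : w * X = q ^ 2 • (X * w))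
    (k : ℕ) (hk : 1 ≤ k) :
    (z * w) * z ^ k - z ^ k * (z * w) = (1 - q ^ (2 * k)) • (z ^ k * X) := by
  clear hk
  induction k with
  | zero => simp
  | succ k ih =>
    have e : (z * w) * z ^ (k + 1) - z ^ (k + 1) * (z * w)
        = ((z * w) * z ^ k - z ^ k * (z * w)) * z + z ^ k * (z * (w * z - z * w)) := by
      rw [pow_succ]
      noncomm_ring
    rw [e, ih, h1, smul_mul_assoc, mul_assoc (z ^ k) X z, h2, mul_smul_comm, mul_smul_comm,
      mul_smul_comm, ← mul_assoc, ← pow_succ, smul_smul, ← add_smul]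
    congr 1
    ring
end

section
/- With the notation of the context, for every integer k ≥ 1 one has z^k * w^k = ∏_{j=0}^{k-1} (z*w + (1 - q^(-2j)) • X) in R, where the product is taken in increasing order of j (the factors pairwise commute, so the order is immaterial). -/
/-- `z^k w^k = ∏_{j=0}^{k-1} (z w + (1 - q^{-2j}) • X)` in a `ℂ`-algebra with the
quantum sphere relations; the product is taken in increasing order of `j`. -/
theorem zpow_mul_wpow (R : Type*) [Ring R] [Algebra ℂ R] (q : ℂ) (hq : q ≠ 0)
    (z w X : R)
    (h1 : w * z - z * w = (1 - q ^ 2) • X)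
    (h2 : X * z = q ^ 2 • (z * X))
    (h3 : w * X = q ^ 2 • (X * w))
    (k : ℕ) (hk : 1 ≤ k) :
    z ^ k * w ^ k =
      ((List.range k).map (fun j => z * w + (1 - q ^ (-(2 * (j : ℤ)))) • X)).prod := by
  have hXw : X * w = (q ^ 2)⁻¹ • (w * X) := by
    rw [h3, smul_smul, inv_mul_cancel₀ (pow_ne_zero 2 hq), one_smul]
  have hzw : z * w * w = w * (z * w) + (1 - (q ^ 2)⁻¹) • (w * X) := by
    have e : w * z = z * w + (1 - q ^ 2) • X := by rw [← h1]; abel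
    rw [← mul_assoc w z w, e, add_mul, smul_mul_assoc, hXw, smul_smul, add_assoc, ← add_smul]
    have : (1 - q ^ 2) * (q ^ 2)⁻¹ + (1 - (q ^ 2)⁻¹) = 0 := by
      field_simp
      ring
    rw [this, zero_smul, add_zero]
  have key : ∀ n : ℕ, z * w * w ^ n = w ^ n * (z * w + (1 - q ^ (-(2 * (n : ℤ)))) • X) := by
    intro n
    induction n with
    | zero => simp
    | succ n ih =>
      have hc : q ^ (-(2 * ((n + 1 : ℕ) : ℤ))) = q ^ (-(2 * (n : ℤ))) * (q ^ 2)⁻¹ := by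
        have : (-(2 * ((n + 1 : ℕ) : ℤ))) = -(2 * (n : ℤ)) + (-2) := by push_cast; ring
        rw [this, zpow_add₀ hq, zpow_neg q 2]
        rfl
      rw [hc, pow_succ, ← mul_assoc, ih, mul_assoc, mul_assoc, add_mul, smul_mul_assoc, hzw, hXw,
        smul_smul, add_assoc, ← add_smul, mul_add, mul_smul_comm]
      have hs : (1 - (q ^ 2)⁻¹ + (1 - q ^ (-(2 * (n : ℤ)))) * (q ^ 2)⁻¹)
          = 1 - q ^ (-(2 * (n : ℤ))) * (q ^ 2)⁻¹ := by ring
      rw [hs]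
      simp only [mul_add, mul_smul_comm]
  clear hk
  have hl : ∀ n : ℕ, (do let a ← List.range n; pure (a : ℤ) : List ℤ)
      = (List.range n).map (fun a : ℕ => (a : ℤ)) := by
    intro n
    rw [List.map_eq_flatMap]
    rfl
  rw [hl]
  induction k with
  | zero => simp
  | succ n ih =>
    rw [List.range_succ, List.map_append, List.map_append, List.prod_append, ← ih,
      List.map_singleton, List.map_singleton,
      List.prod_singleton, mul_assoc, ← key n, pow_succ z, pow_succ' w]
    simp only [mul_assoc]
end

section
/- With the notation of the context, for every integer k ≥ 1 one has w^k * z^k = ∏_{j=1}^{k} (z*w + (1 - q^(2j)) • X) in R, where the product is taken in increasing order of j (the factors pairwise commute, so the order is immaterial). -/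
/-- `w^k z^k = ∏_{j=1}^{k} (z w + (1 - q^{2j}) • X)` in a `ℂ`-algebra with the
quantum sphere relations; the product is taken in increasing order of `j`. -/
theorem wpow_mul_zpow (R : Type*) [Ring R] [Algebra ℂ R] (q : ℂ) (hq : q ≠ 0)
    (z w X : R)
    (h1 : w * z - z * w = (1 - q ^ 2) • X)
    (h2 : X * z = q ^ 2 • (z * X))
    (h3 : w * X = q ^ 2 • (X * w))
    (k : ℕ) (hk : 1 ≤ k) :
    w ^ k * z ^ k =
      ((List.range k).map (fun j => z * w + (1 - q ^ (2 * (j + 1))) • X)).prod := by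
  clear hk
  have hwz : w * z = z * w + (1 - q ^ 2) • X := by rw [← h1]; abel
  have step : ∀ j : ℕ, (z * w + (1 - q ^ (2 * (j + 1))) • X) * z
      = z * (z * w + (1 - q ^ (2 * (j + 1 + 1))) • X) := by
    intro j
    rw [add_mul, mul_assoc, hwz, smul_mul_assoc, h2, mul_add z, mul_add z, mul_smul_comm,
      mul_smul_comm, smul_smul, add_assoc, ← add_smul]
    congr 2
    ring
  have shift : ∀ n : ℕ,
      ((List.range n).map (fun j => z * w + (1 - q ^ (2 * (j + 1))) • X)).prod * z
      = z * ((List.range n).map (fun j => z * w + (1 - q ^ (2 * (j + 1 + 1))) • X)).prod := by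
    intro n
    induction n with
    | zero => simp
    | succ n ih =>
      rw [List.prod_range_succ, List.prod_range_succ, mul_assoc, step, ← mul_assoc, ih, mul_assoc]
  induction k with
  | zero => simp
  | succ k ih =>
    rw [pow_succ', pow_succ, mul_assoc, ← mul_assoc (w ^ k), ih, shift, ← mul_assoc, hwz,
      List.prod_range_succ']
end
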